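/- Let X > 0, A > 0, B ≥ 0 be real numbers. If X ≤ A · log(1 + B·X), then for every η ∈ (0,1), X ≤ A · log( 1 + B · (1/(1-η)) · A · log( (A/(2η)) · (1/X + B) ) ). -/

import Mathlib

theorem solve_implicit_log_ineq_sharp (X A B : ℝ) (hX : 0 < X) (hA : 0 < A) (hB : 0 ≤ B)
    (h : X ≤ A * Real.log (1 + B * X)) :
    ∀ η : ℝ, η ∈ Set.Ioo (0 : ℝ) 1 →
      X ≤ A * Real.log (1 + B * ((1 / (1 - η)) * A *
        Real.log ((A / (2 * η)) * (1 / X + B)))) := by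
  rintro η ⟨hη0, hη1⟩
  have hη : 0 < 1 - η := sub_pos.mpr hη1
  set L := Real.log ((A / (2 * η)) * (1 / X + B)) with hL
  have ht : 0 < η * X / A := by positivity
  have hsplit : Real.log (1 + B * X) = Real.log (2 * (η * X / A)) + L := by
    rw [hL, ← Real.log_mul (by positivity) (by positivity)]
    congr 1
    field_simp
  have hlog : Real.log (2 * (η * X / A)) ≤ η * X / A := by
    rw [Real.log_mul two_ne_zero ht.ne']
    linarith [Real.log_le_sub_one_of_pos ht, Real.log_le_sub_one_of_pos (zero_lt_two (α := ℝ))]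
  have hbound : X ≤ η * X + A * L := by
    calc X ≤ A * (Real.log (2 * (η * X / A)) + L) := hsplit ▸ h
      _ ≤ A * (η * X / A + L) := by gcongr
      _ = η * X + A * L := by field_simp
  have hX_le : X ≤ 1 / (1 - η) * A * L := by
    rw [mul_assoc, one_div_mul_eq_div, le_div_iff₀ hη]
    linarith
  calc X ≤ A * Real.log (1 + B * X) := h
    _ ≤ A * Real.log (1 + B * (1 / (1 - η) * A * L)) := by gcongr
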